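/- arXiv:2209.12156 — 7 statements merged into one kernel-verified Lean document; each statement's English description precedes it below -/
import Mathlib

section
/- Let ρ : ℝ → ℝ be convex and differentiable and let x ∈ ℝ be fixed. Then the function t ↦ M_ρ(x;t) is differentiable on (0,∞), and for every t > 0 its derivative equals −(x − Prox_ρ(x;t))²/(2t²), i.e. ∂M_ρ/∂t(x;t) = −(1/2)·(ρ'(Prox_ρ(x;t)))² = −(1/2)·(∂M_ρ/∂x(x;t))². -/
/-- The Moreau envelope `M_f(x; t) = ⨅ v, (f v + (x - v)^2 / (2t))`. -/
noncomputable def moreau (f : ℝ → ℝ) (x t : ℝ) : ℝ := ⨅ v : ℝ, (f v + (x - v) ^ 2 / (2 * t))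

open Filter Topology Asymptotics

/-- First-order optimality for a minimizer of the Moreau objective. -/
lemma deriv_eq_of_moreau_minimizer {f : ℝ → ℝ} {f' x t p : ℝ} (hf : HasDerivAt f f' p)
    (ht : 0 < t)
    (hp : ∀ v, f p + (x - p) ^ 2 / (2 * t) ≤ f v + (x - v) ^ 2 / (2 * t)) :
    f' = (x - p) / t := by
  have hq : HasDerivAt (fun v => (x - v) ^ 2 / (2 * t)) (-((x - p) / t)) p := by
    refine ((((hasDerivAt_id' p).const_sub x).fun_pow 2).div_const (2 * t)).congr_deriv ?_
    field_simp
    norm_num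
    ring
  have hmin : IsLocalMin (fun v => f v + (x - v) ^ 2 / (2 * t)) p := Eventually.of_forall hp
  have := hmin.hasDerivAt_eq_zero (hf.add hq)
  linarith

/-- The Moreau envelope is attained at a minimizer of its objective. -/
lemma moreau_eq_of_minimizer {f : ℝ → ℝ} {x t p : ℝ}
    (hp : ∀ v, f p + (x - p) ^ 2 / (2 * t) ≤ f v + (x - v) ^ 2 / (2 * t)) :
    moreau f x t = f p + (x - p) ^ 2 / (2 * t) :=
  le_antisymm (ciInf_le ⟨_, Set.forall_mem_range.2 hp⟩ p) (le_ciInf hp)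

/-- Dependence of the proximal point on the parameter, for a monotone derivative `g`. -/
lemma abs_prox_sub_prox_le {g : ℝ → ℝ} (hg : Monotone g) {x s t a b : ℝ}
    (hs : 0 < s) (ht : 0 < t) (ha : g a = (x - a) / s) (hb : g b = (x - b) / t) :
    |a - b| ≤ |x - b| * |1 - s / t| := by
  have hmono : 0 ≤ (g a - g b) * (a - b) := by
    rcases le_total a b with h | h
    · exact mul_nonneg_of_nonpos_of_nonpos (sub_nonpos.2 (hg h)) (sub_nonpos.2 h)
    · exact mul_nonneg (sub_nonneg.2 (hg h)) (sub_nonneg.2 h)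
  have hid : s * ((g a - g b) * (a - b)) =
      (x - b) * (1 - s / t) * (a - b) - (a - b) ^ 2 := by
    rw [ha, hb]
    field_simp
    ring
  have hle : |a - b| * |a - b| ≤ |x - b| * |1 - s / t| * |a - b| := by
    rw [← abs_mul (x - b), ← abs_mul, ← abs_mul, abs_of_nonneg (mul_self_nonneg (a - b))]
    have := le_abs_self ((x - b) * (1 - s / t) * (a - b))
    nlinarith [mul_nonneg hs.le hmono]
  rcases (abs_nonneg (a - b)).eq_or_lt with h | h
  · rw [← h]
    positivity
  · exact le_of_mul_le_mul_right hle h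

/-- Proximal points of a convex differentiable function depend continuously on the parameter. -/
lemma tendsto_prox {g p : ℝ → ℝ} (hg : Monotone g) {x t : ℝ} (ht : 0 < t)
    (hp : ∀ s, 0 < s → g (p s) = (x - p s) / s) : Tendsto p (𝓝 t) (𝓝 (p t)) := by
  rw [tendsto_iff_norm_sub_tendsto_zero]
  have hlim : Tendsto (fun s : ℝ => |x - p t| * |1 - s / t|) (𝓝 t) (𝓝 0) := by
    have hc : Continuous fun s : ℝ => |x - p t| * |1 - s / t| := by fun_prop
    simpa [ht.ne'] using hc.tendsto t
  refine squeeze_zero' (Eventually.of_forall fun _ => norm_nonneg _) ?_ hlim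
  filter_upwards [lt_mem_nhds ht] with s hs
  exact abs_prox_sub_prox_le hg hs ht (hp s hs) (hp t ht)

/-- The derivative in the parameter of a Moreau envelope whose minimizers vary continuously. -/
lemma hasDerivAt_moreau {f p : ℝ → ℝ} {x t : ℝ} (ht : 0 < t)
    (hp : ∀ s : ℝ, 0 < s → ∀ v : ℝ,
      f (p s) + (x - p s) ^ 2 / (2 * s) ≤ f v + (x - v) ^ 2 / (2 * s))
    (hcont : Tendsto p (𝓝 t) (𝓝 (p t))) :
    HasDerivAt (fun s => moreau f x s) (-(x - p t) ^ 2 / (2 * t ^ 2)) t := by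
  have hinv : HasDerivAt (fun s : ℝ => s⁻¹) (-(t ^ 2)⁻¹) t := hasDerivAt_inv ht.ne'
  set r : ℝ → ℝ := fun s => moreau f x s - (x - p t) ^ 2 / 2 * s⁻¹ with hr
  have hbound : ∀ᶠ s in 𝓝 t,
      ‖r s - r t‖ ≤ ‖((x - p s) ^ 2 - (x - p t) ^ 2) / 2 * (s⁻¹ - t⁻¹)‖ := by
    filter_upwards [lt_mem_nhds ht] with s hs
    have hdiv : ∀ y u : ℝ, y / (2 * u) = y / 2 * u⁻¹ := fun y u => by
      rw [div_mul_eq_div_div, div_eq_mul_inv]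
    have hst := hp s hs (p t)
    have hts := hp t ht (p s)
    have hrs : r s = f (p s) + (x - p s) ^ 2 / (2 * s) - (x - p t) ^ 2 / 2 * s⁻¹ := by
      rw [hr, ← moreau_eq_of_minimizer (hp s hs)]
    have hrt : r t = f (p t) + (x - p t) ^ 2 / (2 * t) - (x - p t) ^ 2 / 2 * t⁻¹ := by
      rw [hr, ← moreau_eq_of_minimizer (hp t ht)]
    rw [hrs, hrt]
    simp only [hdiv] at hst hts ⊢
    rw [Real.norm_eq_abs, Real.norm_eq_abs, abs_of_nonpos (by linarith)]
    refine le_trans ?_ (neg_le_abs _)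
    linarith
  have hsq : (fun s => ((x - p s) ^ 2 - (x - p t) ^ 2) / 2) =o[𝓝 t] fun _ => (1 : ℝ) := by
    rw [isLittleO_one_iff]
    rw [show (0 : ℝ) = ((x - p t) ^ 2 - (x - p t) ^ 2) / 2 by ring]
    exact (((hcont.const_sub x).pow 2).sub_const ((x - p t) ^ 2)).div_const 2
  have hr0 : HasDerivAt r 0 t := by
    rw [hasDerivAt_iff_isLittleO]
    simpa using (IsBigO.of_bound' hbound).trans_isLittleO
      (by simpa using hsq.mul_isBigO hinv.differentiableAt.isBigO_sub)
  have hsum := hr0.fun_add (hinv.const_mul ((x - p t) ^ 2 / 2))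
  simp only [hr, sub_add_cancel] at hsum
  refine hsum.congr_deriv ?_
  field_simp
  ring

/-- For convex differentiable `ρ` and fixed `x`, the map `t ↦ M_ρ(x; t)` is
differentiable on `(0, ∞)` with derivative `-(x - Prox_ρ(x;t))^2 / (2 t^2)`, which equals
`-(1/2) (ρ'(Prox_ρ(x;t)))^2` (the square of the `x`-derivative of the envelope).
Here `prox t` denotes the minimizer of `v ↦ ρ v + (x - v)^2/(2t)` for each `t > 0`. -/
theorem stmt3 (ρ ρ' : ℝ → ℝ) (hconv : ConvexOn ℝ Set.univ ρ)
    (hderiv : ∀ y : ℝ, HasDerivAt ρ (ρ' y) y) (x : ℝ)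
    (prox : ℝ → ℝ)
    (hprox : ∀ t : ℝ, 0 < t → ∀ v : ℝ,
      ρ (prox t) + (x - prox t) ^ 2 / (2 * t) ≤ ρ v + (x - v) ^ 2 / (2 * t)) :
    ∀ t : ℝ, 0 < t →
      HasDerivAt (fun s => moreau ρ x s) (-(x - prox t) ^ 2 / (2 * t ^ 2)) t ∧
      -(x - prox t) ^ 2 / (2 * t ^ 2) = -(1 / 2) * (ρ' (prox t)) ^ 2 ∧
      -(x - prox t) ^ 2 / (2 * t ^ 2) = -(1 / 2) * ((x - prox t) / t) ^ 2 := by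
  have hmono : Monotone ρ' := by
    have h := hconv.monotoneOn_deriv fun y _ => (hderiv y).differentiableAt
    rw [funext fun y => (hderiv y).deriv] at h
    exact monotoneOn_univ.1 h
  have hopt : ∀ s, 0 < s → ρ' (prox s) = (x - prox s) / s := fun s hs =>
    deriv_eq_of_moreau_minimizer (hderiv _) hs (hprox s hs)
  intro t ht
  refine ⟨hasDerivAt_moreau ht hprox (tendsto_prox hmono ht hopt), ?_, ?_⟩
  · rw [hopt t ht]
    field_simp
  · field_simp
end

section
/- Let ρ : ℝ → ℝ be convex and twice continuously differentiable and let t > 0. Then the map x ↦ Prox_ρ(x;t) is differentiable on ℝ, with derivative ∂Prox_ρ/∂x(x;t) = 1/(1 + t·ρ''(Prox_ρ(x;t))) at every x ∈ ℝ. -/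
/-- First-order optimality condition for the proximal point `p` of `f` at `x`. -/
theorem add_mul_deriv_eq_of_isMinOn_prox {f : ℝ → ℝ} {f' t x p : ℝ} (ht : 0 < t)
    (hf : HasDerivAt f f' p)
    (hmin : ∀ v, f p + (x - p) ^ 2 / (2 * t) ≤ f v + (x - v) ^ 2 / (2 * t)) :
    p + t * f' = x := by
  have hd : HasDerivAt (fun v => f v + (x - v) ^ 2 / (2 * t))
      (f' + 2 * (x - p) * (-1) / (2 * t)) p := by
    have h := (((hasDerivAt_id p).const_sub x).pow 2).div_const (2 * t)
    exact (hf.add h).congr_deriv (by simp)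
  have hloc : IsLocalMin (fun v => f v + (x - v) ^ 2 / (2 * t)) p :=
    Filter.Eventually.of_forall hmin
  have h0 := hloc.hasDerivAt_eq_zero hd
  field_simp at h0
  linarith

/-- A right inverse of `y ↦ y + t * g y`, with `g` monotone and `t ≥ 0`, is nonexpansive. -/
theorem LipschitzWith.of_add_mul_monotone {g q : ℝ → ℝ} {t : ℝ} (ht : 0 ≤ t) (hg : Monotone g)
    (hq : ∀ x, q x + t * g (q x) = x) : LipschitzWith 1 q := by
  refine LipschitzWith.of_dist_le_mul fun x y => ?_
  rw [NNReal.coe_one, one_mul, Real.dist_eq, Real.dist_eq]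
  have hx := hq x
  have hy := hq y
  rcases le_total (q x) (q y) with h | h
  · have := mul_le_mul_of_nonneg_left (hg h) ht
    rw [abs_of_nonpos (by linarith), abs_of_nonpos (by linarith)]
    linarith
  · have := mul_le_mul_of_nonneg_left (hg h) ht
    rw [abs_of_nonneg (by linarith), abs_of_nonneg (by linarith)]
    linarith

/-- For convex, twice continuously differentiable `ρ` and `t > 0`, the proximal
map `x ↦ Prox_ρ(x; t)` is differentiable on `ℝ` with derivative
`1 / (1 + t ρ''(Prox_ρ(x; t)))` at every `x`.  Here `prox x` denotes the minimizer of
`v ↦ ρ v + (x - v)^2/(2t)`. -/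
theorem stmt4 (ρ ρ' ρ'' : ℝ → ℝ) (hconv : ConvexOn ℝ Set.univ ρ)
    (hd1 : ∀ y : ℝ, HasDerivAt ρ (ρ' y) y) (hd2 : ∀ y : ℝ, HasDerivAt ρ' (ρ'' y) y)
    (hcont : Continuous ρ'') (t : ℝ) (ht : 0 < t)
    (prox : ℝ → ℝ)
    (hprox : ∀ x v : ℝ,
      ρ (prox x) + (x - prox x) ^ 2 / (2 * t) ≤ ρ v + (x - v) ^ 2 / (2 * t)) :
    Differentiable ℝ prox ∧
    ∀ x : ℝ, HasDerivAt prox (1 / (1 + t * ρ'' (prox x))) x := by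
  have hopt : ∀ x, prox x + t * ρ' (prox x) = x := fun x =>
    add_mul_deriv_eq_of_isMinOn_prox ht (hd1 _) (hprox x)
  have hderiv : deriv ρ = ρ' := funext fun y => (hd1 y).deriv
  have hmono : Monotone ρ' := by
    rw [← hderiv, ← monotoneOn_univ]
    exact hconv.monotoneOn_deriv fun y _ => (hd1 y).differentiableAt
  have hnonneg : ∀ y, 0 ≤ ρ'' y := fun y => (hd2 y).deriv ▸ hmono.deriv_nonneg
  have hprox_deriv : ∀ x, HasDerivAt prox (1 / (1 + t * ρ'' (prox x))) x := by
    intro x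
    have hinv : HasDerivAt (fun y => y + t * ρ' y) (1 + t * ρ'' (prox x)) (prox x) :=
      (hasDerivAt_id _).add ((hd2 _).const_mul t)
    have hpos : 0 < 1 + t * ρ'' (prox x) := by
      have := mul_nonneg ht.le (hnonneg (prox x))
      linarith
    rw [one_div]
    exact hinv.of_local_left_inverse
      (LipschitzWith.of_add_mul_monotone ht.le hmono hopt).continuous.continuousAt hpos.ne'
      (Filter.Eventually.of_forall hopt)
  exact ⟨fun x => (hprox_deriv x).differentiableAt, hprox_deriv⟩
end

section
/- Let ρ : ℝ → ℝ be convex and twice continuously differentiable and let t > 0. Then x ↦ M_ρ(x;t) is twice differentiable on ℝ, and its second derivative in x equals ρ''(Prox_ρ(x;t)) / (1 + t·ρ''(Prox_ρ(x;t))) at every x ∈ ℝ. Equivalently, t·∂²M_ρ/∂x²(x;t) = 1 − ∂Prox_ρ/∂x(x;t). -/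
/-- First-order optimality: a minimizer `p` of `v ↦ f v + (x - v)^2 / (2t)` satisfies
`p + t f'(p) = x`. -/
theorem add_mul_eq_of_isMinimizer {f : ℝ → ℝ} {f' t x p : ℝ} (hf : HasDerivAt f f' p)
    (ht : 0 < t)
    (hp : ∀ v : ℝ, f p + (x - p) ^ 2 / (2 * t) ≤ f v + (x - v) ^ 2 / (2 * t)) :
    p + t * f' = x := by
  have hd : HasDerivAt (fun v => f v + (x - v) ^ 2 / (2 * t)) (f' - (x - p) / t) p := by
    have h := hf.add ((((hasDerivAt_id p).const_sub x).pow 2).div_const (2 * t))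
    refine h.congr_deriv ?_
    simp only [id]
    field_simp
    ring
  have h0 := IsLocalMin.hasDerivAt_eq_zero (Filter.Eventually.of_forall hp) hd
  field_simp at h0
  linarith

/-- The infimum defining the Moreau envelope is its value at a minimizer. -/
theorem moreau_eq_of_isMinimizer {f : ℝ → ℝ} {t x p : ℝ}
    (hp : ∀ v : ℝ, f p + (x - p) ^ 2 / (2 * t) ≤ f v + (x - v) ^ 2 / (2 * t)) :
    moreau f x t = f p + (x - p) ^ 2 / (2 * t) :=
  le_antisymm (ciInf_le ⟨_, Set.forall_mem_range.2 hp⟩ p) (le_ciInf hp)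

/-- A right inverse of `v ↦ v + t g(v)`, with `g` monotone, is nonexpansive. -/
theorem lipschitzWith_of_add_mul_rightInverse {g p : ℝ → ℝ} {t : ℝ} (hg : Monotone g)
    (ht : 0 < t) (hp : ∀ x, p x + t * g (p x) = x) : LipschitzWith 1 p := by
  refine LipschitzWith.of_dist_le_mul fun x y => ?_
  rw [NNReal.coe_one, one_mul, Real.dist_eq, Real.dist_eq]
  have hx := hp x
  have hy := hp y
  rcases le_total (p x) (p y) with h | h
  · have := mul_le_mul_of_nonneg_left (hg h) ht.le
    rw [abs_of_nonpos (by linarith), abs_of_nonpos (by linarith)]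
    linarith
  · have := mul_le_mul_of_nonneg_left (hg h) ht.le
    rw [abs_of_nonneg (by linarith), abs_of_nonneg (by linarith)]
    linarith

/-- For convex, twice continuously differentiable `ρ` and `t > 0`, the map
`x ↦ M_ρ(x; t)` is twice differentiable on `ℝ` and its second derivative equals
`ρ''(Prox_ρ(x;t)) / (1 + t ρ''(Prox_ρ(x;t)))` at every `x`; equivalently,
`t ∂²M/∂x² = 1 - ∂Prox/∂x`, where `∂Prox/∂x = 1/(1 + t ρ''(Prox_ρ(x;t)))`.
Here `prox x` denotes the minimizer of `v ↦ ρ v + (x - v)^2/(2t)`. -/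
theorem stmt5 (ρ ρ' ρ'' : ℝ → ℝ) (hconv : ConvexOn ℝ Set.univ ρ)
    (hd1 : ∀ y : ℝ, HasDerivAt ρ (ρ' y) y) (hd2 : ∀ y : ℝ, HasDerivAt ρ' (ρ'' y) y)
    (hcont : Continuous ρ'') (t : ℝ) (ht : 0 < t)
    (prox : ℝ → ℝ)
    (hprox : ∀ x v : ℝ,
      ρ (prox x) + (x - prox x) ^ 2 / (2 * t) ≤ ρ v + (x - v) ^ 2 / (2 * t)) :
    Differentiable ℝ (fun y => moreau ρ y t) ∧
    (∀ x : ℝ,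
      HasDerivAt (fun y => deriv (fun z => moreau ρ z t) y)
        (ρ'' (prox x) / (1 + t * ρ'' (prox x))) x) ∧
    (∀ x : ℝ,
      t * (ρ'' (prox x) / (1 + t * ρ'' (prox x))) = 1 - 1 / (1 + t * ρ'' (prox x))) := by
  have hmono : Monotone ρ' := by
    have h := hconv.monotoneOn_deriv fun y _ => (hd1 y).differentiableAt
    rwa [monotoneOn_univ, funext fun y => (hd1 y).deriv] at h
  have hnonneg (y : ℝ) : 0 ≤ ρ'' y := (hd2 y).nonneg_of_monotone hmono
  have hpos (y : ℝ) : 0 < 1 + t * ρ'' y := by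
    have := mul_nonneg ht.le (hnonneg y)
    linarith
  have hfix (x : ℝ) : prox x + t * ρ' (prox x) = x :=
    add_mul_eq_of_isMinimizer (hd1 _) ht (hprox x)
  have hprox_deriv (x : ℝ) : HasDerivAt prox (1 + t * ρ'' (prox x))⁻¹ x :=
    HasDerivAt.of_local_left_inverse
      (lipschitzWith_of_add_mul_rightInverse hmono ht hfix).continuous.continuousAt
      ((hasDerivAt_id _).add ((hd2 _).const_mul t)) (hpos _).ne'
      (Filter.Eventually.of_forall hfix)
  have henv (x : ℝ) : HasDerivAt (fun y => moreau ρ y t) ((x - prox x) / t) x := by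
    rw [funext fun y => moreau_eq_of_isMinimizer (hprox y)]
    have h := ((hd1 (prox x)).comp x (hprox_deriv x)).add
      ((((hasDerivAt_id x).sub (hprox_deriv x)).pow 2).div_const (2 * t))
    refine h.congr_deriv ?_
    have hρ' : ρ' (prox x) = (x - prox x) / t := by
      rw [eq_div_iff ht.ne']
      linarith [hfix x]
    rw [hρ']
    simp only [id, Pi.sub_apply]
    field_simp
    ring
  refine ⟨fun x => (henv x).differentiableAt, fun x => ?_, fun x => ?_⟩
  · rw [funext fun y => (henv y).deriv]
    refine (((hasDerivAt_id x).sub (hprox_deriv x)).div_const t).congr_deriv ?_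
    have := (hpos (prox x)).ne'
    field_simp
    ring
  · have := (hpos (prox x)).ne'
    field_simp
    ring
end

section
/- (Stein's lemma) Let Z be a standard Gaussian random variable and let g : ℝ → ℝ be continuously differentiable such that E|g'(Z)| < ∞ and E|Z·g(Z)| < ∞. Then E[Z·g(Z)] = E[g'(Z)]. More generally, if W is a random variable independent of Z and a > 0, with E|g'(W+aZ)| < ∞ and E|Z·g(W+aZ)| < ∞, then E[Z·g(W+aZ)] = a·E[g'(W+aZ)]. -/
open MeasureTheory ProbabilityTheory

/-- The standard Gaussian density satisfies `φ' (x) = -x φ (x)`. -/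
lemma hasDerivAt_gaussianPDFReal_zero_one (x : ℝ) :
    HasDerivAt (gaussianPDFReal 0 1) (-x * gaussianPDFReal 0 1 x) x := by
  have h : HasDerivAt (fun y : ℝ => -(y - 0) ^ 2 / (2 * ((1 : NNReal) : ℝ))) (-x) x := by
    refine ((((hasDerivAt_id x).sub_const 0).pow 2).neg.div_const
      (2 * ((1 : NNReal) : ℝ))).congr_deriv ?_
    simp [neg_div]
  rw [gaussianPDFReal_def]
  exact (h.exp.const_mul _).congr_deriv (by ring)

lemma integrable_gaussianReal_zero_one_iff (f : ℝ → ℝ) :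
    Integrable f (gaussianReal 0 1) ↔ Integrable (fun x => f x * gaussianPDFReal 0 1 x) := by
  rw [gaussianReal_of_var_ne_zero 0 one_ne_zero,
    integrable_withDensity_iff (measurable_gaussianPDF 0 1)
      (ae_of_all _ fun _ => gaussianPDF_lt_top)]
  simp only [toReal_gaussianPDF]

/-- Integrability of `z * f z` controls that of a continuous function `f`, since `f` is bounded on
`[-1, 1]`. -/
lemma Continuous.integrable_of_integrable_id_mul {μ : Measure ℝ} [IsFiniteMeasure μ] {f : ℝ → ℝ}
    (hf : Continuous f) (h : Integrable (fun z => z * f z) μ) : Integrable f μ := by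
  obtain ⟨C, hC⟩ := (isCompact_Icc (a := (-1 : ℝ)) (b := 1)).exists_bound_of_continuousOn
    hf.continuousOn
  refine ((integrable_const |C|).add h.norm).mono' hf.aestronglyMeasurable (ae_of_all _ fun z => ?_)
  simp only [Pi.add_apply, norm_mul]
  by_cases hz : z ∈ Set.Icc (-1 : ℝ) 1
  · exact ((hC z hz).trans (le_abs_self C)).trans (le_add_of_nonneg_right (by positivity))
  · have h1 : 1 ≤ ‖z‖ := by
      rw [Real.norm_eq_abs]
      by_contra! hlt
      exact hz ⟨(abs_lt.mp hlt).1.le, (abs_lt.mp hlt).2.le⟩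
    nlinarith [norm_nonneg (f z), abs_nonneg C]

/-- Stein's identity for the standard Gaussian measure. -/
lemma integral_id_mul_gaussianReal {f f' : ℝ → ℝ} (hf : ∀ x, HasDerivAt f (f' x) x)
    (hf' : Integrable f' (gaussianReal 0 1))
    (hzf : Integrable (fun z => z * f z) (gaussianReal 0 1)) :
    ∫ z, z * f z ∂(gaussianReal 0 1) = ∫ z, f' z ∂(gaussianReal 0 1) := by
  have hcont : Continuous f := continuous_iff_continuousAt.2 fun x => (hf x).continuousAt
  have hfi := (integrable_gaussianReal_zero_one_iff f).1 (hcont.integrable_of_integrable_id_mul hzf)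
  rw [integrable_gaussianReal_zero_one_iff] at hf' hzf
  have key := integral_mul_deriv_eq_deriv_mul_of_integrable (fun x _ => hf x)
    (fun x _ => hasDerivAt_gaussianPDFReal_zero_one x)
    (hzf.neg.congr (ae_of_all _ fun x => by simp; ring)) hf' hfi
  rw [integral_gaussianReal_eq_integral_smul one_ne_zero,
    integral_gaussianReal_eq_integral_smul one_ne_zero]
  simp only [smul_eq_mul]
  calc ∫ x, gaussianPDFReal 0 1 x * (x * f x)
      = -∫ x, f x * (-x * gaussianPDFReal 0 1 x) := by
        rw [← integral_neg]
        exact integral_congr_ae (ae_of_all _ fun x => by ring)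
    _ = ∫ x, gaussianPDFReal 0 1 x * f' x := by
        rw [key, neg_neg]
        exact integral_congr_ae (ae_of_all _ fun x => mul_comm _ _)

/-- Stein's identity for `f (w + a z)` under a product measure. -/
lemma integral_snd_mul_prod_gaussianReal {ν : Measure ℝ} [SFinite ν] {f f' : ℝ → ℝ} (a : ℝ)
    (hf : ∀ x, HasDerivAt f (f' x) x)
    (h1 : Integrable (fun p : ℝ × ℝ => f' (p.1 + a * p.2)) (ν.prod (gaussianReal 0 1)))
    (h2 : Integrable (fun p : ℝ × ℝ => p.2 * f (p.1 + a * p.2)) (ν.prod (gaussianReal 0 1))) :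
    ∫ p, p.2 * f (p.1 + a * p.2) ∂(ν.prod (gaussianReal 0 1)) =
      a * ∫ p, f' (p.1 + a * p.2) ∂(ν.prod (gaussianReal 0 1)) := by
  rw [integral_prod _ h2, integral_prod _ h1, ← integral_const_mul]
  refine integral_congr_ae ?_
  filter_upwards [h1.prod_right_ae, h2.prod_right_ae] with w hw1 hw2
  rw [← integral_const_mul]
  refine integral_id_mul_gaussianReal (f := fun z => f (w + a * z)) (fun z => ?_)
    (hw1.const_mul a) hw2
  have h := (hf (w + a * z)).comp z (((hasDerivAt_id z).const_mul a).const_add w)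
  exact h.congr_deriv (by ring)

/-- Stein's lemma: If `Z` is standard Gaussian and `g` is continuously
differentiable with `E|g'(Z)| < ∞` and `E|Z g(Z)| < ∞`, then `E[Z g(Z)] = E[g'(Z)]`.
More generally, if `W` is independent of `Z` and `a > 0`, with the corresponding
integrability, then `E[Z g(W + aZ)] = a E[g'(W + aZ)]`. -/
theorem stmt11 (g g' : ℝ → ℝ) (hg : ∀ x : ℝ, HasDerivAt g (g' x) x)
    (hg'cont : Continuous g')
    (hint1 : Integrable g' (gaussianReal 0 1))
    (hint2 : Integrable (fun z => z * g z) (gaussianReal 0 1)) :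
    (∫ z, z * g z ∂(gaussianReal 0 1)) = ∫ z, g' z ∂(gaussianReal 0 1) ∧
    ∀ (Ω : Type) (_ : MeasureSpace Ω), IsProbabilityMeasure (ℙ : Measure Ω) →
      ∀ (W Z : Ω → ℝ) (a : ℝ), 0 < a → Measurable W → Measurable Z →
        Measure.map Z ℙ = gaussianReal 0 1 → IndepFun W Z ℙ →
        Integrable (fun ω => g' (W ω + a * Z ω)) ℙ →
        Integrable (fun ω => Z ω * g (W ω + a * Z ω)) ℙ →
        (∫ ω, Z ω * g (W ω + a * Z ω) ∂ℙ) = a * ∫ ω, g' (W ω + a * Z ω) ∂ℙ := by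
  refine ⟨integral_id_mul_gaussianReal hg hint1 hint2, ?_⟩
  intro Ω _ _ W Z a _ hW hZ hmap hindep hi1 hi2
  have hgc : Continuous g := continuous_iff_continuousAt.2 fun x => (hg x).continuousAt
  have hWZ : AEMeasurable (fun ω => (W ω, Z ω)) ℙ := (hW.prodMk hZ).aemeasurable
  have hlaw : Measure.map (fun ω => (W ω, Z ω)) ℙ =
      (Measure.map W ℙ).prod (gaussianReal 0 1) := by
    rw [(indepFun_iff_map_prod_eq_prod_map_map hW.aemeasurable hZ.aemeasurable).1 hindep, hmap]
  have hm1 : AEStronglyMeasurable (fun p : ℝ × ℝ => g' (p.1 + a * p.2))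
      (Measure.map (fun ω => (W ω, Z ω)) ℙ) :=
    Continuous.aestronglyMeasurable (by fun_prop)
  have hm2 : AEStronglyMeasurable (fun p : ℝ × ℝ => p.2 * g (p.1 + a * p.2))
      (Measure.map (fun ω => (W ω, Z ω)) ℙ) :=
    Continuous.aestronglyMeasurable (by fun_prop)
  have key := integral_snd_mul_prod_gaussianReal (ν := Measure.map W ℙ) a hg
    (by rw [← hlaw]; exact (integrable_map_measure hm1 hWZ).2 hi1)
    (by rw [← hlaw]; exact (integrable_map_measure hm2 hWZ).2 hi2)
  rwa [← hlaw, integral_map hWZ hm1, integral_map hWZ hm2] at key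
end

section
/- (Theorem 1, equivalence of LOO and AMP state equations for M-estimation) Let ρ : ℝ → ℝ be convex and twice continuously differentiable, let κ ∈ (0,1), τ > 0, λ > 0, let W be a real random variable and Z an independent standard Gaussian, and assume all expectations below are finite. Then the pair of equations (LOO state equations) 1 − κ = E[∂Prox_ρ/∂x(W + τZ; λ)] and κτ² = E[(W + τZ − Prox_ρ(W + τZ; λ))²] holds if and only if the pair of equations (AMP state equations) τ² = (λ²/κ)·E[(∂M_ρ/∂x(W + τZ; λ))²] and κ = λ·E[∂²M_ρ/∂x²(W + τZ; λ)] holds. Here ∂M_ρ/∂x(x;λ) = ρ'(Prox_ρ(x;λ)), ∂²M_ρ/∂x²(x;λ) = ρ''(Prox_ρ(x;λ))/(1+λρ''(Prox_ρ(x;λ))) and ∂Prox_ρ/∂x(x;λ) = 1/(1+λρ''(Prox_ρ(x;λ))). -/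
open MeasureTheory ProbabilityTheory

/-- The derivative of a convex function on `ℝ` has nonnegative derivative. -/
lemma ConvexOn.nonneg_of_hasDerivAt_hasDerivAt {f f' f'' : ℝ → ℝ}
    (hf : ConvexOn ℝ Set.univ f) (hd1 : ∀ y, HasDerivAt f (f' y) y)
    (hd2 : ∀ y, HasDerivAt f' (f'' y) y) (y : ℝ) : 0 ≤ f'' y := by
  have hderiv : deriv f = f' := funext fun x => (hd1 x).deriv
  have hmono : Monotone f' := by
    rw [← monotoneOn_univ, ← hderiv]
    exact hf.monotoneOn_deriv fun x _ => (hd1 x).differentiableAt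
  exact (hd2 y).deriv ▸ hmono.deriv_nonneg

/-- First-order optimality condition for the proximal operator. -/
lemma sub_eq_mul_of_forall_add_sq_div_le {f : ℝ → ℝ} {f' t x p : ℝ} (ht : t ≠ 0)
    (hf : HasDerivAt f f' p)
    (hmin : ∀ v, f p + (x - p) ^ 2 / (2 * t) ≤ f v + (x - v) ^ 2 / (2 * t)) :
    x - p = t * f' := by
  have hd : HasDerivAt (fun v => f v + (x - v) ^ 2 / (2 * t))
      (f' + 2 * (x - p) * -1 / (2 * t)) p := by
    simpa using hf.fun_add ((((hasDerivAt_id p).const_sub x).pow 2).div_const (2 * t))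
  have hzero := IsLocalMin.hasDerivAt_eq_zero (Filter.Eventually.of_forall hmin) hd
  field_simp at hzero
  linarith

/-- Theorem 1, equivalence of LOO and AMP state equations for M-estimation:
For convex twice continuously differentiable `ρ`, `κ ∈ (0,1)`, `τ > 0`, `λ > 0`, `W` a real
random variable and `Z` an independent standard Gaussian (all expectations finite), the LOO
state equations hold iff the AMP state equations hold.  Here `prox x` is the minimizer of
`v ↦ ρ v + (x - v)^2/(2λ)`, and the derivative formulas
`∂Prox/∂x = 1/(1 + λρ''(prox x))`, `∂M/∂x = ρ'(prox x)`,
`∂²M/∂x² = ρ''(prox x)/(1 + λρ''(prox x))` are substituted in. -/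
theorem stmt12 {Ω : Type*} [MeasureSpace Ω] [IsProbabilityMeasure (ℙ : Measure Ω)]
    (ρ ρ' ρ'' : ℝ → ℝ) (hconv : ConvexOn ℝ Set.univ ρ)
    (hd1 : ∀ y : ℝ, HasDerivAt ρ (ρ' y) y) (hd2 : ∀ y : ℝ, HasDerivAt ρ' (ρ'' y) y)
    (hcont : Continuous ρ'')
    (κ τ lam : ℝ) (hκ : κ ∈ Set.Ioo (0 : ℝ) 1) (hτ : 0 < τ) (hlam : 0 < lam)
    (W Z : Ω → ℝ) (hW : Measurable W) (hZ : Measurable Z)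
    (hZlaw : Measure.map Z ℙ = gaussianReal 0 1) (hindep : IndepFun W Z ℙ)
    (prox : ℝ → ℝ)
    (hprox : ∀ x v : ℝ,
      ρ (prox x) + (x - prox x) ^ 2 / (2 * lam) ≤ ρ v + (x - v) ^ 2 / (2 * lam))
    (hint1 : Integrable (fun ω => 1 / (1 + lam * ρ'' (prox (W ω + τ * Z ω)))) ℙ)
    (hint2 : Integrable (fun ω => (W ω + τ * Z ω - prox (W ω + τ * Z ω)) ^ 2) ℙ)
    (hint3 : Integrable (fun ω => (ρ' (prox (W ω + τ * Z ω))) ^ 2) ℙ)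
    (hint4 : Integrable
      (fun ω => ρ'' (prox (W ω + τ * Z ω)) / (1 + lam * ρ'' (prox (W ω + τ * Z ω)))) ℙ) :
    -- LOO state equations
    (1 - κ = (∫ ω, 1 / (1 + lam * ρ'' (prox (W ω + τ * Z ω))) ∂ℙ) ∧
     κ * τ ^ 2 = ∫ ω, (W ω + τ * Z ω - prox (W ω + τ * Z ω)) ^ 2 ∂ℙ)
    ↔
    -- AMP state equations
    (τ ^ 2 = (lam ^ 2 / κ) * ∫ ω, (ρ' (prox (W ω + τ * Z ω))) ^ 2 ∂ℙ ∧
     κ = lam * ∫ ω, ρ'' (prox (W ω + τ * Z ω)) /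
            (1 + lam * ρ'' (prox (W ω + τ * Z ω))) ∂ℙ) := by
  obtain ⟨hκ0, -⟩ := hκ
  have hsq : (∫ ω, (W ω + τ * Z ω - prox (W ω + τ * Z ω)) ^ 2 ∂ℙ)
      = lam ^ 2 * ∫ ω, (ρ' (prox (W ω + τ * Z ω))) ^ 2 ∂ℙ := by
    rw [← integral_const_mul]
    congr with ω
    rw [sub_eq_mul_of_forall_add_sq_div_le hlam.ne' (hd1 _) (hprox _), mul_pow]
  have hsum : (∫ ω, 1 / (1 + lam * ρ'' (prox (W ω + τ * Z ω))) ∂ℙ)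
      = 1 - lam * ∫ ω, ρ'' (prox (W ω + τ * Z ω)) /
            (1 + lam * ρ'' (prox (W ω + τ * Z ω))) ∂ℙ := by
    rw [eq_sub_iff_add_eq, ← integral_const_mul, ← integral_add hint1 (hint4.const_mul lam)]
    have hone (ω : Ω) : 1 / (1 + lam * ρ'' (prox (W ω + τ * Z ω))) +
        lam * (ρ'' (prox (W ω + τ * Z ω)) / (1 + lam * ρ'' (prox (W ω + τ * Z ω)))) = 1 := by
      have hnonneg := hconv.nonneg_of_hasDerivAt_hasDerivAt hd1 hd2 (prox (W ω + τ * Z ω))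
      have hpos : 0 < 1 + lam * ρ'' (prox (W ω + τ * Z ω)) := by positivity
      field_simp
    simp only [hone, integral_const, probReal_univ, one_smul]
  rw [hsq, hsum, and_comm, sub_right_inj, div_mul_eq_mul_div, eq_div_iff hκ0.ne', mul_comm κ]
end

section
/- (Theorem 2, CGMT state equations imply AMP state equations for LASSO) Let λ* > 0, κ* > 0, σ* ≥ 0, r* > 0. Let Z be standard Gaussian and b₀ an independent real random variable with E[b₀²] = r*². Define η(x;t) = sign(x)·max(|x|−t,0) and η'(x;t) = 1 if |x| > t, 0 otherwise. Suppose (α, σ, λ, θ, r, τ) with σ > 0, τ > 0, λ ≥ 0 satisfies the six CGMT state equations: (1) −α/(στ) + θ − 1 + (α+λ)/(λ+1) = 0; (2) −1/(2τ) + r*²κ*α²/(2σ²τ) − (τκ*/2)·E[η(rZ+θb₀;λ*)²] + σ/(λ+1) = 0; (3) r² − r*²κ* − σ*² + 2[(α+λ)r*²κ* + λσ*²]/(λ+1) − [(α+λ)²r*²κ* + σ² + λ²σ*²]/(λ+1)² = 0; (4) r*²κ*α − στκ*·E[b₀·η(rZ+θb₀;λ*)] = 0; (5) λ = στκ*·E[η'(rZ+θb₀;λ*)];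 (6) σ/(2τ²) + r*²κ*α²/(2στ²) − (σκ*/2)·E[η(rZ+θb₀;λ*)²] = 0. Then τ₁ := r·(λ+1) and γ₁ := λ*·λ satisfy the AMP state equations: τ₁² = σ*² + κ*·E[(η(b₀ + τ₁Z; λ* + γ₁) − b₀)²] and γ₁ = κ*(γ₁ + λ*)·E[η'(b₀ + τ₁Z; λ* + γ₁)]. -/
open MeasureTheory ProbabilityTheory

/-- The soft-thresholding function `η(x; t) = sign(x) · max(|x| - t, 0)`. -/
noncomputable def softThresh (x t : ℝ) : ℝ := Real.sign x * max (|x| - t) 0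

/-- The (a.e.) derivative of soft-thresholding in its first argument:
`η'(x; t) = 1` if `|x| > t`, `0` otherwise. -/
noncomputable def softThresh' (x t : ℝ) : ℝ := if t < |x| then 1 else 0

theorem softThresh_div {L : ℝ} (hL : 0 < L) (x t : ℝ) :
    softThresh x (t * L) = L * softThresh (x / L) t := by
  have hsign : Real.sign (x / L) = Real.sign x := by
    rcases lt_trichotomy x 0 with h | h | h
    · rw [Real.sign_of_neg h, Real.sign_of_neg (div_neg_of_neg_of_pos h hL)]
    · simp [h]
    · rw [Real.sign_of_pos h, Real.sign_of_pos (div_pos h hL)]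
  have hmax : max (|x| - t * L) 0 = L * max (|x / L| - t) 0 := by
    rw [mul_max_of_nonneg _ _ hL.le, abs_div, abs_of_pos hL, mul_zero]
    congr 1
    field_simp
  rw [softThresh, softThresh, hsign, hmax]
  ring

theorem softThresh'_div {L : ℝ} (hL : 0 < L) (x t : ℝ) :
    softThresh' x (t * L) = softThresh' (x / L) t := by
  simp only [softThresh', abs_div, abs_of_pos hL, lt_div_iff₀ hL]

theorem abs_softThresh_le (x : ℝ) {t : ℝ} (ht : 0 ≤ t) : |softThresh x t| ≤ |x| := by
  have hm : max (|x| - t) 0 ≤ |x| := max_le (by linarith) (abs_nonneg x)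
  have hs : |Real.sign x| ≤ 1 := by
    rcases Real.sign_apply_eq x with h | h | h <;> simp [h]
  rw [softThresh, abs_mul, abs_of_nonneg (le_max_right (|x| - t) 0)]
  calc |Real.sign x| * max (|x| - t) 0 ≤ 1 * |x| :=
        mul_le_mul hs hm (le_max_right _ _) zero_le_one
    _ = |x| := one_mul _

theorem measurable_softThresh (t : ℝ) : Measurable fun x => softThresh x t := by
  have hs : Measurable Real.sign := by
    unfold Real.sign
    exact Measurable.ite measurableSet_Iio measurable_const
      (Measurable.ite measurableSet_Ioi measurable_const measurable_const)
  unfold softThresh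
  fun_prop

theorem memLp_softThresh_comp {Ω : Type*} [MeasurableSpace Ω] {μ : Measure Ω} {p : ENNReal}
    {X : Ω → ℝ} (hX : MemLp X p μ) {t : ℝ} (ht : 0 ≤ t) :
    MemLp (fun ω => softThresh (X ω) t) p μ :=
  hX.mono ((measurable_softThresh t).comp_aemeasurable
    hX.aestronglyMeasurable.aemeasurable).aestronglyMeasurable
    (Filter.Eventually.of_forall fun ω => abs_softThresh_le (X ω) ht)

theorem memLp_two_of_map_eq_gaussianReal {Ω : Type*} [MeasurableSpace Ω] {μ : Measure Ω}
    {Z : Ω → ℝ} (hZ : Measurable Z) {m : ℝ} {v : NNReal} (h : μ.map Z = gaussianReal m v) :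
    MemLp Z 2 μ := by
  have hid : MemLp id 2 (μ.map Z) := by
    rw [h]
    exact memLp_id_gaussianReal 2
  exact hid.comp_of_map hZ.aemeasurable

/-- Theorem 2, CGMT state equations imply AMP state equations for LASSO:
if `(α, σ, λ, θ, r, τ)` with `σ, τ > 0`, `λ ≥ 0` satisfies the six CGMT state equations,
then `τ₁ := r(λ+1)` and `γ₁ := λ*λ` satisfy the AMP state equations. -/
theorem stmt15 {Ω : Type*} [MeasureSpace Ω] [IsProbabilityMeasure (ℙ : Measure Ω)]
    (lamStar κStar σStar rStar : ℝ)
    (hlamStar : 0 < lamStar) (hκStar : 0 < κStar) (hσStar : 0 ≤ σStar) (hrStar : 0 < rStar)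
    (Z b₀ : Ω → ℝ) (hZ : Measurable Z) (hb₀ : Measurable b₀)
    (hZlaw : Measure.map Z ℙ = gaussianReal 0 1) (hindep : IndepFun b₀ Z ℙ)
    (hb₀sq : Integrable (fun ω => (b₀ ω) ^ 2) ℙ)
    (hb₀moment : (∫ ω, (b₀ ω) ^ 2 ∂ℙ) = rStar ^ 2)
    (α σ lam θ r τ : ℝ) (hσ : 0 < σ) (hτ : 0 < τ) (hlam : 0 ≤ lam)
    -- (1)
    (hse1 : -α / (σ * τ) + θ - 1 + (α + lam) / (lam + 1) = 0)
    -- (2)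
    (hse2 : -1 / (2 * τ) + rStar ^ 2 * κStar * α ^ 2 / (2 * σ ^ 2 * τ)
        - (τ * κStar / 2) * (∫ ω, (softThresh (r * Z ω + θ * b₀ ω) lamStar) ^ 2 ∂ℙ)
        + σ / (lam + 1) = 0)
    -- (3)
    (hse3 : r ^ 2 - rStar ^ 2 * κStar - σStar ^ 2
        + 2 * ((α + lam) * rStar ^ 2 * κStar + lam * σStar ^ 2) / (lam + 1)
        - ((α + lam) ^ 2 * rStar ^ 2 * κStar + σ ^ 2 + lam ^ 2 * σStar ^ 2) / (lam + 1) ^ 2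
        = 0)
    -- (4)
    (hse4 : rStar ^ 2 * κStar * α
        - σ * τ * κStar * (∫ ω, b₀ ω * softThresh (r * Z ω + θ * b₀ ω) lamStar ∂ℙ) = 0)
    -- (5)
    (hse5 : lam = σ * τ * κStar * ∫ ω, softThresh' (r * Z ω + θ * b₀ ω) lamStar ∂ℙ)
    -- (6)
    (hse6 : σ / (2 * τ ^ 2) + rStar ^ 2 * κStar * α ^ 2 / (2 * σ * τ ^ 2)
        - (σ * κStar / 2) * (∫ ω, (softThresh (r * Z ω + θ * b₀ ω) lamStar) ^ 2 ∂ℙ) = 0) :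
    -- AMP state equations for τ₁ = r(λ+1), γ₁ = λ*·λ
    (r * (lam + 1)) ^ 2 = σStar ^ 2 + κStar *
        ∫ ω, (softThresh (b₀ ω + (r * (lam + 1)) * Z ω) (lamStar + lamStar * lam) - b₀ ω) ^ 2 ∂ℙ ∧
    lamStar * lam = κStar * (lamStar * lam + lamStar) *
        ∫ ω, softThresh' (b₀ ω + (r * (lam + 1)) * Z ω) (lamStar + lamStar * lam) ∂ℙ := by
  have hL : 0 < lam + 1 := by linarith
  have hb : MemLp b₀ 2 ℙ := (memLp_two_iff_integrable_sq hb₀.aestronglyMeasurable).2 hb₀sq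
  have hη : MemLp (fun ω => softThresh (r * Z ω + θ * b₀ ω) lamStar) 2 ℙ :=
    memLp_softThresh_comp
      (((memLp_two_of_map_eq_gaussianReal hZ hZlaw).const_mul r).add (hb.const_mul θ)) hlamStar.le
  have hηsq := hη.integrable_sq
  have hbη : Integrable (fun ω => b₀ ω * softThresh (r * Z ω + θ * b₀ ω) lamStar) ℙ :=
    hb.integrable_mul hη
  have hστ : σ * τ = lam + 1 := by
    field_simp at hse2 hse6
    have h : (σ * τ - (lam + 1)) * σ ^ 2 = 0 := by
      linear_combination (1 / 2) * hse2 - (lam + 1) / 2 * hse6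
    rcases mul_eq_zero.1 h with h | h
    · linarith
    · exact absurd h (by positivity)
  have hθ : θ = 1 / (lam + 1) := by
    rw [hστ] at hse1
    field_simp at hse1 ⊢
    linarith
  have harg : ∀ ω, (b₀ ω + r * (lam + 1) * Z ω) / (lam + 1) = r * Z ω + θ * b₀ ω := by
    intro ω
    rw [hθ]
    field_simp
    ring
  have hthr : lamStar + lamStar * lam = lamStar * (lam + 1) := by ring
  have hthr' : lamStar * lam + lamStar = lamStar * (lam + 1) := by ring
  simp only [hthr, hthr', softThresh_div hL, softThresh'_div hL, harg]
  refine ⟨?_, ?_⟩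
  · have hexp : ∫ ω, ((lam + 1) * softThresh (r * Z ω + θ * b₀ ω) lamStar - b₀ ω) ^ 2 ∂ℙ
        = (lam + 1) ^ 2 * (∫ ω, (softThresh (r * Z ω + θ * b₀ ω) lamStar) ^ 2 ∂ℙ)
          - 2 * (lam + 1) * (∫ ω, b₀ ω * softThresh (r * Z ω + θ * b₀ ω) lamStar ∂ℙ)
          + rStar ^ 2 := by
      have hdiff : Integrable (fun ω =>
          (lam + 1) ^ 2 * (softThresh (r * Z ω + θ * b₀ ω) lamStar) ^ 2
            - 2 * (lam + 1) * (b₀ ω * softThresh (r * Z ω + θ * b₀ ω) lamStar)) ℙ :=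
        (hηsq.const_mul _).sub (hbη.const_mul _)
      rw [← hb₀moment, ← integral_const_mul, ← integral_const_mul,
        ← integral_sub (hηsq.const_mul _) (hbη.const_mul _),
        ← integral_add hdiff hb₀sq]
      congr 1
      ext ω
      ring
    rw [hexp]
    generalize (∫ ω, (softThresh (r * Z ω + θ * b₀ ω) lamStar) ^ 2 ∂ℙ) = A at *
    generalize (∫ ω, b₀ ω * softThresh (r * Z ω + θ * b₀ ω) lamStar ∂ℙ) = B at *
    have hA : σ ^ 2 + rStar ^ 2 * κStar * α ^ 2 = κStar * (lam + 1) ^ 2 * A := by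
      rw [← hστ]
      field_simp at hse6
      linear_combination hse6
    rw [hστ] at hse4
    field_simp at hse3
    linear_combination hse3 + hA - 2 * hse4
  · rw [hστ] at hse5
    linear_combination lamStar * hse5
end

section
/- (Theorem 3, first identity) Let ρ(t) = log(1+exp(t)) and l(t) := ρ(−t) = log(1+exp(−t)). Let κ > 0, α > 0, σ > 0, r > 0, λ > 0. Let Z be standard Gaussian and V an independent random variable with density p_V(v) = (1/√(2π))·e^{−v²/2}·(2/(1+e^{−rv})), and let Z', V' be i.i.d. standard Gaussians. Then E[(l'(Prox_l(√κ·α·Z + r·σ·V; λ)))²] = E[2ρ'(r·V')·(ρ'(Prox_ρ(−√κ·α·Z' − r·σ·V'; λ)))²]. -/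
open MeasureTheory ProbabilityTheory

/-- The logistic loss `ρ(t) = log(1 + eᵗ)`. -/
noncomputable def logisticRho (t : ℝ) : ℝ := Real.log (1 + Real.exp t)

/-- Its derivative, the sigmoid `ρ'(t) = 1/(1 + e^{-t})`. -/
noncomputable def logisticRho' (t : ℝ) : ℝ := 1 / (1 + Real.exp (-t))

/-- The flipped loss `l(t) = ρ(-t) = log(1 + e^{-t})`. -/
noncomputable def logisticL (t : ℝ) : ℝ := Real.log (1 + Real.exp (-t))

/-- Its derivative `l'(t) = -ρ'(-t) = -1/(1 + eᵗ)`. -/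
noncomputable def logisticL' (t : ℝ) : ℝ := -(1 / (1 + Real.exp t))

lemma logisticRho_midpoint_le (a b : ℝ) :
    logisticRho ((a + b) / 2) ≤ (logisticRho a + logisticRho b) / 2 := by
  unfold logisticRho
  have ha := Real.exp_pos (a / 2)
  have hb := Real.exp_pos (b / 2)
  have ea : Real.exp a = Real.exp (a / 2) ^ 2 := by rw [← Real.exp_nat_mul]; push_cast; ring_nf
  have eb : Real.exp b = Real.exp (b / 2) ^ 2 := by rw [← Real.exp_nat_mul]; push_cast; ring_nf
  have em : Real.exp ((a + b) / 2) = Real.exp (a / 2) * Real.exp (b / 2) := by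
    rw [← Real.exp_add]; ring_nf
  rw [ea, eb, em, ← Real.log_mul (by positivity) (by positivity), le_div_iff₀ two_pos, mul_comm,
    ← Nat.cast_two, ← Real.log_pow]
  apply Real.log_le_log (by positivity)
  nlinarith [sq_nonneg (Real.exp (a / 2) - Real.exp (b / 2))]

/-- Minimizers of the proximal objective of the logistic loss are unique. -/
lemma logisticRho_prox_unique {lam x a b : ℝ} (hlam : 0 < lam)
    (ha : ∀ v, logisticRho a + (x - a) ^ 2 / (2 * lam)
      ≤ logisticRho v + (x - v) ^ 2 / (2 * lam))
    (hb : ∀ v, logisticRho b + (x - b) ^ 2 / (2 * lam)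
      ≤ logisticRho v + (x - v) ^ 2 / (2 * lam)) : a = b := by
  have h1 := ha ((a + b) / 2)
  have h2 := hb ((a + b) / 2)
  have h3 := logisticRho_midpoint_le a b
  have key : (x - (a + b) / 2) ^ 2 / (2 * lam)
      = ((x - a) ^ 2 / (2 * lam) + (x - b) ^ 2 / (2 * lam)) / 2 - (a - b) ^ 2 / (8 * lam) := by
    field_simp
    ring
  have h4 : (a - b) ^ 2 / (8 * lam) ≤ 0 := by linarith
  have h5 : (a - b) ^ 2 ≤ 0 := by
    by_contra! h
    exact absurd h4 (not_le.mpr (by positivity))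
  nlinarith [pow_eq_zero_iff (two_ne_zero) |>.mp (le_antisymm h5 (sq_nonneg (a - b)))]

/-- A proximal map is monotone, whatever the function. -/
lemma prox_monotone {f p : ℝ → ℝ} {lam : ℝ} (hlam : 0 < lam)
    (hp : ∀ x v, f (p x) + (x - p x) ^ 2 / (2 * lam) ≤ f v + (x - v) ^ 2 / (2 * lam)) :
    Monotone p := by
  intro x y hxy
  rcases hxy.eq_or_lt with rfl | hlt
  · rfl
  have h1 := hp x (p y)
  have h2 := hp y (p x)
  have h3 : ((x - p x) ^ 2 + (y - p y) ^ 2) / (2 * lam)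
      ≤ ((x - p y) ^ 2 + (y - p x) ^ 2) / (2 * lam) := by
    rw [add_div, add_div]; linarith
  rw [div_le_div_iff_of_pos_right (by positivity)] at h3
  by_contra! h
  nlinarith [mul_pos (sub_pos.mpr hlt) (sub_pos.mpr h)]

lemma logisticRho'_nonneg (t : ℝ) : 0 ≤ logisticRho' t := by
  unfold logisticRho'; positivity

@[fun_prop]
lemma measurable_logisticRho' : Measurable logisticRho' := by
  unfold logisticRho'; fun_prop

/-- The density `φ(v) · 2ρ'(rv)` reweights the standard Gaussian by `2ρ'(rv)`. -/
lemma withDensity_logistic_eq (r : ℝ) :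
    (volume.withDensity (fun v : ℝ =>
      ENNReal.ofReal ((1 / Real.sqrt (2 * Real.pi)) * Real.exp (-v ^ 2 / 2)
        * (2 / (1 + Real.exp (-(r * v)))))))
      = (gaussianReal 0 1).withDensity (fun v => ENNReal.ofReal (2 * logisticRho' (r * v))) := by
  rw [gaussianReal_of_var_ne_zero 0 one_ne_zero,
    ← withDensity_mul _ (measurable_gaussianPDF 0 1) (by fun_prop)]
  congr 1
  ext v
  rw [Pi.mul_apply, gaussianPDF, ← ENNReal.ofReal_mul (gaussianPDFReal_nonneg 0 1 v)]
  congr 1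
  simp [gaussianPDFReal, logisticRho', div_eq_mul_inv]

/-- Reweighting the second of two independent variables by a density moves that density into
the integrand. -/
lemma integral_comp_prodMk_withDensity {Ω : Type*} [MeasurableSpace Ω] {P : Measure Ω}
    [IsProbabilityMeasure P] {μ ν : Measure ℝ} [SFinite μ] [SFinite ν] {X Y X' Y' : Ω → ℝ} {w : ℝ → ℝ}
    (hX : Measurable X) (hY : Measurable Y) (hX' : Measurable X') (hY' : Measurable Y')
    (hw : Measurable w) (hw0 : ∀ y, 0 ≤ w y)
    (hXlaw : P.map X = μ) (hYlaw : P.map Y = ν.withDensity (fun y => ENNReal.ofReal (w y)))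
    (hXY : IndepFun X Y P)
    (hX'law : P.map X' = μ) (hY'law : P.map Y' = ν) (hX'Y' : IndepFun X' Y' P)
    {G : ℝ × ℝ → ℝ} (hG : Measurable G) :
    ∫ ω, G (X ω, Y ω) ∂P = ∫ ω, w (Y' ω) * G (X' ω, Y' ω) ∂P := by
  have hlaw : P.map (fun ω => (X ω, Y ω))
      = (μ.prod ν).withDensity (fun z => ENNReal.ofReal (w z.2)) := by
    rw [(indepFun_iff_map_prod_eq_prod_map_map hX.aemeasurable hY.aemeasurable).mp hXY,
      hXlaw, hYlaw, prod_withDensity_right (by fun_prop)]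
  have hlaw' : P.map (fun ω => (X' ω, Y' ω)) = μ.prod ν := by
    rw [(indepFun_iff_map_prod_eq_prod_map_map hX'.aemeasurable hY'.aemeasurable).mp hX'Y',
      hX'law, hY'law]
  rw [← integral_map (f := G) (hX.prodMk hY).aemeasurable hG.aestronglyMeasurable, hlaw,
    integral_withDensity_eq_integral_toReal_smul (by fun_prop) (by simp),
    ← integral_map (φ := fun ω => (X' ω, Y' ω)) (f := fun z => w z.2 * G z)
      (hX'.prodMk hY').aemeasurable (by fun_prop), hlaw']
  simp [ENNReal.toReal_ofReal, hw0]

/-- Theorem 3, first identity: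
`E[(l'(Prox_l(√κ α Z + r σ V; λ)))²] = E[2ρ'(rV') (ρ'(Prox_ρ(-√κ α Z' - r σ V'; λ)))²]`,
where `Z` is standard Gaussian, `V` is independent with density
`(1/√(2π)) e^{-v²/2} · 2ρ'(rv)`, and `Z', V'` are i.i.d. standard Gaussians.
`proxl x` (resp. `proxρ x`) is the minimizer of `v ↦ l(v) + (x-v)²/(2λ)`
(resp. `v ↦ ρ(v) + (x-v)²/(2λ)`). -/
theorem stmt18 {Ω : Type*} [MeasureSpace Ω] [IsProbabilityMeasure (ℙ : Measure Ω)]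
    (κ α σ r lam : ℝ) (hκ : 0 < κ) (hα : 0 < α) (hσ : 0 < σ) (hr : 0 < r) (hlam : 0 < lam)
    (Z V Z' V' : Ω → ℝ)
    (hZ : Measurable Z) (hV : Measurable V) (hZ' : Measurable Z') (hV' : Measurable V')
    (hZlaw : Measure.map Z ℙ = gaussianReal 0 1)
    (hVlaw : Measure.map V ℙ = volume.withDensity (fun v =>
      ENNReal.ofReal ((1 / Real.sqrt (2 * Real.pi)) * Real.exp (-v ^ 2 / 2)
        * (2 / (1 + Real.exp (-(r * v)))))))
    (hindepZV : IndepFun Z V ℙ)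
    (hZ'law : Measure.map Z' ℙ = gaussianReal 0 1)
    (hV'law : Measure.map V' ℙ = gaussianReal 0 1)
    (hindepZ'V' : IndepFun Z' V' ℙ)
    (proxl proxρ : ℝ → ℝ)
    (hproxl : ∀ x v : ℝ,
      logisticL (proxl x) + (x - proxl x) ^ 2 / (2 * lam)
        ≤ logisticL v + (x - v) ^ 2 / (2 * lam))
    (hproxρ : ∀ x v : ℝ,
      logisticRho (proxρ x) + (x - proxρ x) ^ 2 / (2 * lam)
        ≤ logisticRho v + (x - v) ^ 2 / (2 * lam)) :
    (∫ ω, (logisticL' (proxl (Real.sqrt κ * α * Z ω + r * σ * V ω))) ^ 2 ∂ℙ)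
      = ∫ ω, 2 * logisticRho' (r * V' ω)
          * (logisticRho' (proxρ (-(Real.sqrt κ) * α * Z' ω - r * σ * V' ω))) ^ 2 ∂ℙ := by
  have hprox (x : ℝ) : proxρ (-x) = -proxl x := by
    refine logisticRho_prox_unique hlam (hproxρ (-x)) fun v => ?_
    have h := hproxl x (-v)
    simp only [logisticL, logisticRho, neg_neg] at h ⊢
    rwa [show (-x - -proxl x) ^ 2 = (x - proxl x) ^ 2 by ring,
      show (-x - v) ^ 2 = (x - -v) ^ 2 by ring]
  have hmeas : Measurable proxρ := (prox_monotone hlam hproxρ).measurable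
  rw [withDensity_logistic_eq] at hVlaw
  have key := integral_comp_prodMk_withDensity hZ hV hZ' hV'
    (w := fun v => 2 * logisticRho' (r * v)) (by fun_prop)
    (fun v => mul_nonneg two_pos.le (logisticRho'_nonneg _))
    hZlaw hVlaw hindepZV hZ'law hV'law hindepZ'V'
    (G := fun z => logisticRho' (proxρ (-(Real.sqrt κ) * α * z.1 - r * σ * z.2)) ^ 2)
    (by fun_prop)
  rw [← key]
  congr 1
  ext ω
  rw [show -(Real.sqrt κ) * α * Z ω - r * σ * V ω
    = -(Real.sqrt κ * α * Z ω + r * σ * V ω) by ring, hprox]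
  simp [logisticL', logisticRho']
end
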